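/- arXiv:2309.17243 — 10 statements merged into one kernel-verified Lean document; each statement's English description precedes it below -/
import Mathlib

section
/- For every real number x with 0 ≤ x ≤ 1, one has 0.42·(2/(1+x)) + 0.58·min(1.515 + x, 2) ≤ 1.7257. -/
/-- The key inequality combining the set-based rounding (per-positive-edge
guarantee `2x/(1+x)`) and the pivot-based rounding (guarantee `min(1.515+x,2)`)
with mixing weights `0.42` and `0.58`. -/
theorem combined_rounding_ratio (x : ℝ) (hx0 : 0 ≤ x) (hx1 : x ≤ 1) :
    0.42 * (2 / (1 + x)) + 0.58 * min (1.515 + x) 2 ≤ 1.7257 := by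
  have hpos : 0 < 1 + x := by linarith
  rcases le_total x 0.485 with h | h
  · have hdiv : 0.42 * (2 / (1 + x)) ≤ 0.847 - 0.58 * x := by
      rw [← mul_div_assoc, div_le_iff₀ hpos]
      nlinarith [mul_nonneg hx0 (sub_nonneg.2 h)]
    linarith [min_le_left (1.515 + x) 2]
  · have hdiv : 2 / (1 + x) ≤ 2 / 1.485 := by
      gcongr
      linarith
    linarith [min_le_right (1.515 + x) 2]
end

section
/- Let (V, E⁺ ⊎ E⁻) be a finite Correlation Clustering instance and let ε be a real number with 0 < ε ≤ 10⁻⁸. Let K ⊆ V with |K| ≥ 2 be such that every vertex u ∈ K has at least (1−9ε)|K| neighbors in K with respect to E⁺ ∪ {self-loops} (i.e., the set {v ∈ K : uv ∈ E⁺ or v = u} has size ≥ (1−9ε)|K|), and every vertex u ∈ K has at most 36ε|K| positive neighbors outside K. Then there exists a clustering of minimum cost in which K is entirely contained in a single part. -/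
open Finset
open scoped Classical

/-- `sameCluster σ e` holds iff the two endpoints of the unordered pair `e`
receive the same label under the clustering `σ`. -/
def sameCluster {V : Type*} (σ : V → ℕ) : Sym2 V → Prop :=
  Sym2.lift ⟨fun u v => σ u = σ v, fun _ _ => propext ⟨Eq.symm, Eq.symm⟩⟩

/-- The cost of a clustering `σ`: the number of positive edges cut plus
the number of negative edges not cut. -/
noncomputable def costCC {V : Type*} (Eplus Eminus : Finset (Sym2 V)) (σ : V → ℕ) : ℕ :=
  (Eplus.filter fun e => ¬ sameCluster σ e).card +
    (Eminus.filter fun e => sameCluster σ e).card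

/-- `(u, v)` is an atomic pair: both endpoints lie in a common atom. -/
def IsAtomicPair {V : Type*} (𝒦 : Finset (Finset V)) (u v : V) : Prop :=
  ∃ K ∈ 𝒦, u ∈ K ∧ v ∈ K

/-- A clustering is good w.r.t. the preclustered instance `(𝒦, Eadm)` if every
atomic pair is co-clustered and every non-admissible pair is separated. -/
def IsGood {V : Type*} (𝒦 : Finset (Finset V)) (Eadm : Finset (Sym2 V)) (σ : V → ℕ) : Prop :=
  (∀ u v : V, IsAtomicPair 𝒦 u v → σ u = σ v) ∧
  (∀ u v : V, u ≠ v → ¬ IsAtomicPair 𝒦 u v → s(u, v) ∉ Eadm → σ u ≠ σ v)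

/-- The signed weight of a pair: `1` if positive, `0` on the diagonal and `-1` otherwise. -/
noncomputable def signedWeight {V : Type*} (Eplus : Finset (Sym2 V)) (u v : V) : ℝ :=
  if s(u, v) ∈ Eplus then 1 else if u = v then 0 else -1

/-- The total weight of the ordered pairs that `σ` puts together. -/
noncomputable def agreement {V : Type*} [Fintype V] (w : V → V → ℝ) (σ : V → ℕ) : ℝ :=
  ∑ u, ∑ v, w u v * if σ u = σ v then 1 else 0

lemma signedWeight_comm {V : Type*} (Eplus : Finset (Sym2 V)) (u v : V) :
    signedWeight Eplus u v = signedWeight Eplus v u := by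
  simp only [signedWeight, Sym2.eq_swap (a := u), eq_comm (a := u)]

/-- Summing a function of unordered pairs over ordered pairs counts every pair twice. -/
lemma sum_sum_ite_ne_sym2 {V : Type*} [Fintype V] [DecidableEq V] (f : Sym2 V → ℝ) :
    ∑ u, ∑ v, (if u = v then 0 else f s(u, v)) =
      2 * ∑ e with ¬ e.IsDiag, f e := by
  rw [← Fintype.sum_prod_type' (fun u v : V => if u = v then 0 else f s(u, v))]
  rw [← Finset.sum_fiberwise (g := fun p : V × V => s(p.1, p.2))]
  rw [Finset.mul_sum, Finset.sum_filter]
  refine Finset.sum_congr rfl fun e _ => ?_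
  induction e with | _ a b
  by_cases hab : a = b
  · subst hab
    simp only [Sym2.mk_isDiag_iff, not_true_eq_false, if_false]
    refine Finset.sum_eq_zero fun p hp => ?_
    simp only [Finset.mem_filter, Sym2.eq_iff] at hp
    rw [if_pos]
    rcases hp.2 with h | h <;> exact h.1.trans h.2.symm
  · have h : (univ.filter fun p : V × V => s(p.1, p.2) = s(a, b)) = {(a, b), (b, a)} := by
      ext ⟨x, y⟩
      simp
    rw [h, Finset.sum_pair (by simp [hab])]
    simp [hab, Ne.symm hab, Sym2.eq_swap (a := b)]
    ring

lemma two_mul_costCC {V : Type*} [Fintype V] [DecidableEq V] (Eplus Eminus : Finset (Sym2 V))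
    (hdisj : Disjoint Eplus Eminus)
    (hpart : Eplus ∪ Eminus = Finset.univ.filter fun e : Sym2 V => ¬ e.IsDiag) (σ : V → ℕ) :
    2 * (costCC Eplus Eminus σ : ℝ) =
      2 * (Eplus.card : ℝ) - agreement (signedWeight Eplus) σ := by
  have hpos : ∀ e ∈ Eplus, ¬ e.IsDiag := fun e he => by
    have : e ∈ Eplus ∪ Eminus := Finset.mem_union_left _ he
    rw [hpart] at this
    simpa using this
  have key := sum_sum_ite_ne_sym2 (V := V) fun e =>
    (if e ∈ Eplus then (1 : ℝ) else -1) * if sameCluster σ e then 1 else 0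
  have hag : agreement (signedWeight Eplus) σ = ∑ u, ∑ v, (if u = v then 0 else
      (if s(u, v) ∈ Eplus then (1 : ℝ) else -1) * if sameCluster σ s(u, v) then 1 else 0) := by
    refine Finset.sum_congr rfl fun u _ => Finset.sum_congr rfl fun v _ => ?_
    by_cases huv : u = v
    · subst huv
      have : s(u, u) ∉ Eplus := fun h => hpos _ h (by simp)
      simp [signedWeight, this]
    · simp only [signedWeight, huv, sameCluster, Sym2.lift_mk, if_false]
      by_cases h : σ u = σ v <;> simp [h]
  rw [hag, key, ← hpart, Finset.sum_union hdisj]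
  have h1 : ∑ e ∈ Eplus, (if e ∈ Eplus then (1 : ℝ) else -1) *
      (if sameCluster σ e then 1 else 0) = (Eplus.filter fun e => sameCluster σ e).card := by
    rw [Finset.card_filter, Nat.cast_sum]
    exact Finset.sum_congr rfl fun e he => by simp [he]
  have h2 : ∑ e ∈ Eminus, (if e ∈ Eplus then (1 : ℝ) else -1) *
      (if sameCluster σ e then 1 else 0) = -((Eminus.filter fun e => sameCluster σ e).card : ℝ) := by
    rw [Finset.card_filter, Nat.cast_sum, ← Finset.sum_neg_distrib]
    refine Finset.sum_congr rfl fun e he => ?_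
    rw [if_neg (Finset.disjoint_right.mp hdisj he)]
    split_ifs <;> simp
  have h3 := Finset.card_filter_add_card_filter_not (s := Eplus) (fun e => sameCluster σ e)
  have h3' : ((Eplus.filter fun e => sameCluster σ e).card : ℝ) +
      (Eplus.filter fun e => ¬ sameCluster σ e).card = Eplus.card := by exact_mod_cast h3
  rw [h1, h2, costCC]
  push_cast
  linarith

/-- The effect of giving all vertices of `S` the label `c`. -/
lemma agreement_relabel_sub {V : Type*} [Fintype V] [DecidableEq V] (w : V → V → ℝ)
    (hw : ∀ u v, w u v = w v u) (σ : V → ℕ) (S : Finset V) (c : ℕ) :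
    agreement w (fun u => if u ∈ S then c else σ u) - agreement w σ =
      ∑ u ∈ S, ∑ v ∈ S, w u v * (1 - if σ u = σ v then 1 else 0) +
      2 * ∑ u ∈ S, ∑ v ∈ Sᶜ,
        w u v * ((if σ v = c then 1 else 0) - if σ u = σ v then 1 else 0) := by
  set D : V → V → ℝ := fun u v =>
    w u v * (if (if u ∈ S then c else σ u) = (if v ∈ S then c else σ v) then 1 else 0) -
      w u v * (if σ u = σ v then 1 else 0) with hD
  have hsymm : ∀ u v, D u v = D v u := fun u v => by
    simp only [hD, hw u v, eq_comm (a := σ u), eq_comm (a := if u ∈ S then c else σ u)]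
  have hsplit : agreement w (fun u => if u ∈ S then c else σ u) - agreement w σ =
      ∑ u ∈ S, ∑ v ∈ S, D u v + 2 * ∑ u ∈ S, ∑ v ∈ Sᶜ, D u v +
        ∑ u ∈ Sᶜ, ∑ v ∈ Sᶜ, D u v := by
    have hcross : ∑ u ∈ Sᶜ, ∑ v ∈ S, D u v = ∑ u ∈ S, ∑ v ∈ Sᶜ, D u v := by
      rw [Finset.sum_comm]
      exact Finset.sum_congr rfl fun u _ => Finset.sum_congr rfl fun v _ => hsymm v u
    simp only [agreement, ← Finset.sum_sub_distrib]
    change ∑ u, ∑ v, D u v = _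
    rw [← Finset.sum_add_sum_compl S]
    simp_rw [← Finset.sum_add_sum_compl S (fun v => D _ v)]
    rw [Finset.sum_add_distrib, Finset.sum_add_distrib, hcross]
    ring
  have h0 : ∑ u ∈ Sᶜ, ∑ v ∈ Sᶜ, D u v = 0 :=
    Finset.sum_eq_zero fun u hu => Finset.sum_eq_zero fun v hv => by
      rw [Finset.mem_compl] at hu hv
      simp [hD, hu, hv]
  rw [hsplit, h0, add_zero]
  congr 1
  · refine Finset.sum_congr rfl fun u hu => Finset.sum_congr rfl fun v hv => ?_
    simp only [hD, hu, hv, if_true]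
    ring
  · congr 1
    refine Finset.sum_congr rfl fun u hu => Finset.sum_congr rfl fun v hv => ?_
    rw [Finset.mem_compl] at hv
    simp only [hD, hu, hv, if_true, if_false, eq_comm (a := c)]
    ring

/-- A labelling of maximum agreement is constant on a dense, almost isolated set `K`. -/
lemma eq_on_of_agreement_maximal {V : Type*} [Fintype V] [DecidableEq V] (Eplus : Finset (Sym2 V))
    (hdiag : ∀ u, s(u, u) ∉ Eplus) (σ : V → ℕ)
    (hmax : ∀ σ' : V → ℕ, agreement (signedWeight Eplus) σ' ≤ agreement (signedWeight Eplus) σ)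
    (K : Finset V) (δ : ℝ) (hδ : δ ≤ 1 / 100)
    (hin : ∀ u ∈ K,
      ((K.filter fun v => ¬ (s(u, v) ∈ Eplus ∨ v = u)).card : ℝ) ≤ δ * K.card)
    (hout : ∀ u ∈ K, ((Kᶜ.filter fun v => s(u, v) ∈ Eplus).card : ℝ) ≤ 4 * δ * K.card) :
    ∀ u ∈ K, ∀ v ∈ K, σ u = σ v := by
  intro a ha
  set w := signedWeight Eplus with hwdef
  set k : ℝ := (K.card : ℝ) with hk
  have hkpos : 0 < k := by
    rw [hk]; exact_mod_cast Finset.card_pos.mpr ⟨a, ha⟩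
  have hw0 : ∀ u, w u u = 0 := fun u => by simp [hwdef, signedWeight, hdiag u]
  have hw1 : ∀ u v, w u v ≤ 1 := fun u v => by
    simp only [hwdef, signedWeight]; split_ifs <;> norm_num
  have hwge : ∀ u v, -1 ≤ w u v := fun u v => by
    simp only [hwdef, signedWeight]; split_ifs <;> norm_num
  have exchange : ∀ (S : Finset V) (c : ℕ),
      ∑ u ∈ S, ∑ v ∈ S, w u v * (1 - if σ u = σ v then 1 else 0) +
      2 * ∑ u ∈ S, ∑ v ∈ Sᶜ,
        w u v * ((if σ v = c then 1 else 0) - if σ u = σ v then 1 else 0) ≤ 0 := fun S c => by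
    rw [← agreement_relabel_sub w (signedWeight_comm Eplus)]
    linarith [hmax fun u => if u ∈ S then c else σ u]
  obtain ⟨c₀, hc₀⟩ : ∃ c₀, ∀ v, σ v ≠ c₀ :=
    ⟨univ.sup σ + 1, fun v => by
      have := Finset.le_sup (f := σ) (Finset.mem_univ v)
      omega⟩
  -- positive contribution of a vertex to the outside of `K`
  have hposout : ∀ u ∈ K, ∀ T ⊆ Kᶜ,
      ∑ v ∈ T, w u v ≤ 8 * δ * k - T.card ∧ ∑ v ∈ T, w u v ≤ 4 * δ * k := by
    intro u hu T hT
    have hle : ((T.filter fun v => s(u, v) ∈ Eplus).card : ℝ) ≤ 4 * δ * k :=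
      le_trans (by exact_mod_cast Finset.card_le_card (Finset.filter_subset_filter _ hT)) (hout u hu)
    have hne : ∀ v ∈ T, u ≠ v := fun v hv h => by
      have := hT hv
      rw [Finset.mem_compl] at this
      exact this (h ▸ hu)
    have hsum : ∑ v ∈ T, w u v =
        2 * ((T.filter fun v => s(u, v) ∈ Eplus).card : ℝ) - T.card := by
      rw [Finset.card_filter, Nat.cast_sum, Finset.mul_sum, Finset.card_eq_sum_ones, Nat.cast_sum,
        ← Finset.sum_sub_distrib]
      refine Finset.sum_congr rfl fun v hv => ?_
      simp only [hwdef, signedWeight, hne v hv, if_false]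
      split_ifs <;> norm_num
    have hcard : ((T.filter fun v => s(u, v) ∈ Eplus).card : ℝ) ≤ T.card := by
      exact_mod_cast Finset.card_filter_le _ _
    constructor <;> linarith
  have hposin : ∀ u ∈ K, ∀ T ⊆ K, u ∉ T → (T.card : ℝ) - 2 * δ * k ≤ ∑ v ∈ T, w u v := by
    intro u hu T hT huT
    have hle : ((T.filter fun v => ¬ (s(u, v) ∈ Eplus ∨ v = u)).card : ℝ) ≤ δ * k :=
      le_trans (by exact_mod_cast Finset.card_le_card (Finset.filter_subset_filter _ hT)) (hin u hu)
    have hsum : ∑ v ∈ T, w u v =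
        T.card - 2 * ((T.filter fun v => ¬ (s(u, v) ∈ Eplus ∨ v = u)).card : ℝ) := by
      rw [Finset.card_filter, Nat.cast_sum, Finset.mul_sum, Finset.card_eq_sum_ones, Nat.cast_sum,
        ← Finset.sum_sub_distrib]
      refine Finset.sum_congr rfl fun v hv => ?_
      have hvu : v ≠ u := fun h => huT (h ▸ hv)
      by_cases hp : s(u, v) ∈ Eplus
      · simp [hwdef, signedWeight, hp]
      · simp [hwdef, signedWeight, hp, hvu, hvu.symm]; norm_num
    linarith
  -- some vertex of `K` shares its cluster with almost all of `K`
  obtain ⟨r, hr, hrK⟩ : ∃ r ∈ K, ((K.filter fun v => σ r ≠ σ v).card : ℝ) ≤ 10 * δ * k := by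
    by_contra! hcon
    have h := exchange K c₀
    have hA : ∀ u ∈ K, ((K.filter fun v => σ u ≠ σ v).card : ℝ) - 2 * δ * k ≤
        ∑ v ∈ K, w u v * (1 - if σ u = σ v then 1 else 0) := fun u hu => by
      refine (hposin u hu _ (Finset.filter_subset _ _) (by simp)).trans_eq ?_
      rw [Finset.sum_filter]
      exact Finset.sum_congr rfl fun v _ => by by_cases e : σ u = σ v <;> simp [e]
    have hB : ∀ u ∈ K, -(4 * δ * k) ≤ ∑ v ∈ Kᶜ,
        w u v * ((if σ v = c₀ then 1 else 0) - if σ u = σ v then 1 else 0) := fun u hu => by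
      have := (hposout u hu (Kᶜ.filter fun v => σ u = σ v) (Finset.filter_subset _ _)).2
      refine (neg_le_neg this).trans_eq ?_
      rw [Finset.sum_filter, ← Finset.sum_neg_distrib]
      exact Finset.sum_congr rfl fun v _ => by by_cases e : σ u = σ v <;> simp [e, hc₀]
    have : 0 < ∑ u ∈ K, (∑ v ∈ K, w u v * (1 - if σ u = σ v then 1 else 0) +
        2 * ∑ v ∈ Kᶜ, w u v * ((if σ v = c₀ then 1 else 0) - if σ u = σ v then 1 else 0)) :=
      Finset.sum_pos (fun u hu => by linarith [hA u hu, hB u hu, hcon u hu]) ⟨a, ha⟩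
    rw [Finset.sum_add_distrib, ← Finset.mul_sum] at this
    linarith
  have hrcard : ((K.filter fun v => σ r = σ v).card : ℝ) ≥ k - 10 * δ * k := by
    have h := Finset.card_filter_add_card_filter_not (s := K) (fun v => σ r = σ v)
    have h' : ((K.filter fun v => σ r = σ v).card : ℝ) +
        (K.filter fun v => ¬ σ r = σ v).card = k := by rw [hk]; exact_mod_cast h
    simp only [ne_eq] at hrK
    linarith
  -- the cluster of that vertex has few vertices outside `K`
  have hrout : ((Kᶜ.filter fun v => σ r = σ v).card : ℝ) ≤ 8 * δ * k := by
    by_contra! hcon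
    set S := K.filter fun v => σ r = σ v with hS
    have h := exchange S c₀
    have h1 : ∑ u ∈ S, ∑ v ∈ S, w u v * (1 - if σ u = σ v then (1 : ℝ) else 0) = 0 :=
      Finset.sum_eq_zero fun u hu => Finset.sum_eq_zero fun v hv => by
        have hu' := (Finset.mem_filter.mp hu).2
        have hv' := (Finset.mem_filter.mp hv).2
        simp [← hu', ← hv']
    have h2 : 0 < ∑ u ∈ S, ∑ v ∈ Sᶜ,
        w u v * ((if σ v = c₀ then 1 else 0) - if σ u = σ v then 1 else 0) := by
      refine Finset.sum_pos (fun u hu => ?_) ⟨r, by simp [hS, hr]⟩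
      obtain ⟨huK, hu'⟩ := Finset.mem_filter.mp hu
      have hpo := (hposout u huK (Kᶜ.filter fun v => σ r = σ v) (Finset.filter_subset _ _)).1
      have : Kᶜ.filter (fun v => σ r = σ v) = Sᶜ.filter fun v => σ u = σ v := by
        ext v
        simp only [hS, Finset.mem_filter, Finset.mem_compl, ← hu']
        tauto
      have heq : ∑ v ∈ Sᶜ, w u v * ((if σ v = c₀ then 1 else 0) - if σ u = σ v then 1 else 0) =
          -∑ v ∈ Kᶜ.filter (fun v => σ r = σ v), w u v := by
        rw [this, Finset.sum_filter, ← Finset.sum_neg_distrib]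
        exact Finset.sum_congr rfl fun v _ => by by_cases e : σ u = σ v <;> simp [e, hc₀]
      rw [heq]
      linarith
    linarith
  -- every vertex of `K` belongs to that cluster
  have hall : ∀ x ∈ K, σ r = σ x := by
    intro x hx
    by_contra hne
    have h := exchange {x} (σ r)
    have hsum : ∑ v ∈ ({x} : Finset V)ᶜ,
        w x v * ((if σ v = σ r then 1 else 0) - if σ x = σ v then 1 else 0) =
        (∑ v ∈ K.filter (fun v => σ r = σ v), w x v +
          ∑ v ∈ Kᶜ.filter (fun v => σ r = σ v), w x v) -
        (∑ v ∈ K.filter (fun v => σ x = σ v), w x v +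
          ∑ v ∈ Kᶜ.filter (fun v => σ x = σ v), w x v) := by
      have := Finset.sum_add_sum_compl {x} fun v =>
        w x v * ((if σ v = σ r then (1 : ℝ) else 0) - if σ x = σ v then 1 else 0)
      rw [Finset.sum_singleton, hw0, zero_mul, zero_add] at this
      rw [this]
      simp only [Finset.sum_filter, Finset.sum_add_sum_compl]
      rw [← Finset.sum_sub_distrib]
      refine Finset.sum_congr rfl fun v _ => ?_
      simp only [eq_comm (a := σ v)]
      split_ifs <;> ring
    simp only [Finset.sum_singleton, hw0, zero_mul, zero_add] at h
    rw [hsum] at h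
    have h1 := hposin x hx (K.filter fun v => σ r = σ v) (Finset.filter_subset _ _) (by simp [hne])
    have h2 : -((Kᶜ.filter fun v => σ r = σ v).card : ℝ) ≤
        ∑ v ∈ Kᶜ.filter (fun v => σ r = σ v), w x v := by
      have := Finset.card_nsmul_le_sum (Kᶜ.filter fun v => σ r = σ v) (w x) (-1)
        fun v _ => hwge x v
      simpa using this
    have h3 : ∑ v ∈ K.filter (fun v => σ x = σ v), w x v ≤ 10 * δ * k := by
      have h4 := Finset.sum_le_card_nsmul (K.filter fun v => σ x = σ v) (w x) 1
        fun v _ => hw1 x v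
      have h5 : (K.filter fun v => σ x = σ v) ⊆ K.filter fun v => σ r ≠ σ v :=
        Finset.monotone_filter_right K fun v _ hv => fun h => hne (h.trans hv.symm)
      have h6 : ((K.filter fun v => σ x = σ v).card : ℝ) ≤
          (K.filter fun v => σ r ≠ σ v).card := by exact_mod_cast Finset.card_le_card h5
      simp only [nsmul_eq_mul, mul_one] at h4
      linarith
    have h4 := (hposout x hx (Kᶜ.filter fun v => σ x = σ v) (Finset.filter_subset _ _)).2
    nlinarith
  exact fun v hv => (hall a ha).symm.trans (hall v hv)

/-- Lemma 3.7 (atom structure in preclustering): if every vertex of `K`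
(`|K| ≥ 2`) has at least `(1-9ε)|K|` neighbors in `K` with respect to
`E⁺ ∪ {self-loops}` and at most `36ε|K|` positive neighbors outside `K`,
then some minimum-cost clustering keeps `K` in a single part. -/
theorem atom_in_one_cluster {V : Type*} [Fintype V] [DecidableEq V]
    (Eplus Eminus : Finset (Sym2 V))
    (hdisj : Disjoint Eplus Eminus)
    (hpart : Eplus ∪ Eminus = Finset.univ.filter fun e : Sym2 V => ¬ e.IsDiag)
    (ε : ℝ) (hε0 : 0 < ε) (hε1 : ε ≤ 1e-8)
    (K : Finset V) (hK : 2 ≤ K.card)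
    (hin : ∀ u ∈ K,
      (1 - 9 * ε) * (K.card : ℝ) ≤
        ((K.filter fun v => s(u, v) ∈ Eplus ∨ v = u).card : ℝ))
    (hout : ∀ u ∈ K,
      (((Finset.univ \ K).filter fun v => s(u, v) ∈ Eplus).card : ℝ) ≤
        36 * ε * (K.card : ℝ)) :
    ∃ σ : V → ℕ,
      (∀ σ' : V → ℕ, costCC Eplus Eminus σ ≤ costCC Eplus Eminus σ') ∧
      (∀ u ∈ K, ∀ v ∈ K, σ u = σ v) := by
  refine ⟨Function.argmin (costCC Eplus Eminus), fun σ' => Function.argmin_le _ σ', ?_⟩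
  have hdiag : ∀ u, s(u, u) ∉ Eplus := fun u hu => by
    have : s(u, u) ∈ Eplus ∪ Eminus := Finset.mem_union_left _ hu
    simp [hpart] at this
  refine eq_on_of_agreement_maximal Eplus hdiag _ (fun σ' => ?_) K (9 * ε) (by linarith) ?_ ?_
  · have h1 := two_mul_costCC Eplus Eminus hdisj hpart σ'
    have h2 := two_mul_costCC Eplus Eminus hdisj hpart (Function.argmin (costCC Eplus Eminus))
    have h3 : (costCC Eplus Eminus (Function.argmin (costCC Eplus Eminus)) : ℝ) ≤
        costCC Eplus Eminus σ' := by exact_mod_cast Function.argmin_le _ σ'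
    linarith
  · intro u hu
    have h := Finset.card_filter_add_card_filter_not (s := K) fun v => s(u, v) ∈ Eplus ∨ v = u
    have h' : ((K.filter fun v => s(u, v) ∈ Eplus ∨ v = u).card : ℝ) +
        (K.filter fun v => ¬ (s(u, v) ∈ Eplus ∨ v = u)).card = K.card := by exact_mod_cast h
    linarith [hin u hu]
  · intro u hu
    have h := hout u hu
    rw [← Finset.compl_eq_univ_sdiff] at h
    linarith
end

section
/- Let (V, E⁺ ⊎ E⁻) be a finite Correlation Clustering instance, ε > 0, and K, C ⊆ V with C ∩ K ≠ ∅. Suppose every vertex u ∈ K has at most 36ε|K| positive neighbors outside K, and |C \ K| > 73ε|K|. Then the number of negative edges with one endpoint in C ∩ K and the other in C \ K is strictly greater than the number of positive edges with one endpoint in C ∩ K and the other in C \ K. Consequently, for any clustering containing C as a part, replacing the part C by the two parts C ∩ K and C \ K strictly decreases the cost. -/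
open Finset
open scoped Classical

/-- Edges of `E` between disjoint sets `A` and `B` correspond to the pairs in `A ×ˢ B` spanning
an edge of `E`. -/
lemma card_filter_product_mk_mem {V : Type*} [DecidableEq V] (E : Finset (Sym2 V))
    {A B : Finset V} (hAB : Disjoint A B) :
    ((A ×ˢ B).filter fun p => s(p.1, p.2) ∈ E).card =
      (E.filter fun e => ∃ a ∈ A, ∃ b ∈ B, s(a, b) = e).card := by
  refine Finset.card_bij (fun p _ => s(p.1, p.2)) ?_ ?_ ?_
  · rintro ⟨a, b⟩ h
    simp only [mem_filter, mem_product] at h ⊢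
    exact ⟨h.2, a, h.1.1, b, h.1.2, rfl⟩
  · rintro ⟨a, b⟩ h ⟨a', b'⟩ h' heq
    simp only [mem_filter, mem_product] at h h'
    rcases Sym2.eq_iff.1 heq with ⟨rfl, rfl⟩ | ⟨rfl, rfl⟩
    · rfl
    · exact absurd h'.1.2 (Finset.disjoint_left.1 hAB h.1.1)
  · intro e h
    obtain ⟨he, a, ha, b, hb, rfl⟩ := Finset.mem_filter.1 h
    exact ⟨(a, b), by simp [ha, hb, he], rfl⟩

lemma card_filter_product_eq_sum {α β : Type*} (A : Finset α) (B : Finset β)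
    (P : α × β → Prop) [DecidablePred P] :
    ((A ×ˢ B).filter P).card = ∑ a ∈ A, (B.filter fun b => P (a, b)).card := by
  simp only [Finset.card_filter, Finset.sum_product]

/-- If splitting a part separates exactly the pairs between `A` and `B`, and more negative than
positive edges run between them, then the cost decreases. -/
lemma costCC_lt_of_split {V : Type*} [DecidableEq V] (Eplus Eminus : Finset (Sym2 V))
    {A B : Finset V} (hAB : Disjoint A B)
    (hlt : ((A ×ˢ B).filter fun p => s(p.1, p.2) ∈ Eplus).card <
      ((A ×ˢ B).filter fun p => s(p.1, p.2) ∈ Eminus).card)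
    {σ σ' : V → ℕ} (hsame : ∀ a ∈ A, ∀ b ∈ B, σ a = σ b)
    (hσ' : ∀ u v : V, σ' u = σ' v ↔
      (σ u = σ v ∧ ¬(u ∈ A ∧ v ∈ B) ∧ ¬(u ∈ B ∧ v ∈ A))) :
    costCC Eplus Eminus σ' < costCC Eplus Eminus σ := by
  rw [card_filter_product_mk_mem _ hAB, card_filter_product_mk_mem _ hAB] at hlt
  obtain ⟨cross, hcross⟩ : ∃ P : Sym2 V → Prop, ∀ e, P e ↔ ∃ a ∈ A, ∃ b ∈ B, s(a, b) = e :=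
    ⟨_, fun _ => Iff.rfl⟩
  simp only [← hcross] at hlt
  replace hlt : (Eplus.filter cross).card < (Eminus.filter cross).card := by convert hlt
  have hcross_mk (u v : V) : cross s(u, v) ↔ (u ∈ A ∧ v ∈ B) ∨ (u ∈ B ∧ v ∈ A) := by
    simp only [hcross, Sym2.eq_iff]
    grind
  have hcross_same (e : Sym2 V) : cross e → sameCluster σ e := by
    rw [hcross]
    rintro ⟨a, ha, b, hb, rfl⟩
    exact hsame a ha b hb
  have hsplit (e : Sym2 V) : sameCluster σ' e ↔ sameCluster σ e ∧ ¬ cross e := by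
    induction e with
    | _ u v =>
      rw [hcross_mk, not_or]
      exact hσ' u v
  have hplus : (Eplus.filter fun e => ¬ sameCluster σ' e).card =
      (Eplus.filter fun e => ¬ sameCluster σ e).card + (Eplus.filter cross).card := by
    rw [← Finset.card_union_of_disjoint
      (Finset.disjoint_filter.2 fun e _ h hc => h (hcross_same e hc)), ← Finset.filter_or]
    congr 1
    refine Finset.filter_congr fun e _ => ?_
    rw [hsplit]
    tauto
  have hminus : (Eminus.filter fun e => sameCluster σ e).card =
      (Eminus.filter fun e => sameCluster σ' e).card + (Eminus.filter cross).card := by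
    rw [← Finset.card_union_of_disjoint
      (Finset.disjoint_filter.2 fun e _ h hc => ((hsplit e).1 h).2 hc), ← Finset.filter_or]
    congr 1
    refine Finset.filter_congr fun e _ => ?_
    have := hcross_same e
    rw [hsplit]
    tauto
  unfold costCC
  omega

/-- The exchange claim inside the proof of Lemma 3.7: if every vertex of `K` has
at most `36ε|K|` positive neighbors outside `K`, `C ∩ K ≠ ∅`, and
`|C \ K| > 73ε|K|`, then the negative edges between `C ∩ K` and `C \ K`
strictly outnumber the positive ones; consequently, splitting the part `C` into
`C ∩ K` and `C \ K` strictly decreases the cost of any clustering having `C`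
as a part. -/
theorem exchange_split {V : Type*} [Fintype V] [DecidableEq V]
    (Eplus Eminus : Finset (Sym2 V))
    (hdisj : Disjoint Eplus Eminus)
    (hpart : Eplus ∪ Eminus = Finset.univ.filter fun e : Sym2 V => ¬ e.IsDiag)
    (ε : ℝ) (hε0 : 0 < ε)
    (K C : Finset V) (hCK : (C ∩ K).Nonempty)
    (hout : ∀ u ∈ K,
      (((Finset.univ \ K).filter fun v => s(u, v) ∈ Eplus).card : ℝ) ≤
        36 * ε * (K.card : ℝ))
    (hbig : 73 * ε * (K.card : ℝ) < ((C \ K).card : ℝ)) :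
    ((((C ∩ K) ×ˢ (C \ K)).filter fun p => s(p.1, p.2) ∈ Eplus).card <
      (((C ∩ K) ×ˢ (C \ K)).filter fun p => s(p.1, p.2) ∈ Eminus).card) ∧
    (∀ σ σ' : V → ℕ,
      (∃ c : ℕ, ∀ v : V, v ∈ C ↔ σ v = c) →
      (∀ u v : V, σ' u = σ' v ↔
        (σ u = σ v ∧ ¬(u ∈ C ∩ K ∧ v ∈ C \ K) ∧ ¬(u ∈ C \ K ∧ v ∈ C ∩ K))) →
      costCC Eplus Eminus σ' < costCC Eplus Eminus σ) := by
  have hAB : Disjoint (C ∩ K) (C \ K) :=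
    Finset.disjoint_left.2 fun v h h' => (Finset.mem_sdiff.1 h').2 (Finset.mem_inter.1 h).2
  have hlt : (((C ∩ K) ×ˢ (C \ K)).filter fun p => s(p.1, p.2) ∈ Eplus).card <
      (((C ∩ K) ×ˢ (C \ K)).filter fun p => s(p.1, p.2) ∈ Eminus).card := by
    rw [card_filter_product_eq_sum, card_filter_product_eq_sum]
    refine Finset.sum_lt_sum_of_nonempty hCK fun u hu => ?_
    have huK : u ∈ K := (Finset.mem_inter.1 hu).2
    have hKpos : (0 : ℝ) < K.card := by exact_mod_cast Finset.card_pos.2 ⟨u, huK⟩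
    have hle : ((C \ K).filter fun v => s(u, v) ∈ Eplus).card ≤
        ((Finset.univ \ K).filter fun v => s(u, v) ∈ Eplus).card :=
      Finset.card_le_card
        (Finset.filter_subset_filter _ (Finset.sdiff_subset_sdiff (Finset.subset_univ C) le_rfl))
    have hneg : ((C \ K).filter fun v => s(u, v) ∉ Eplus) =
        (C \ K).filter fun v => s(u, v) ∈ Eminus := by
      refine Finset.filter_congr fun v hv => ?_
      have hne : u ≠ v := fun h => (Finset.mem_sdiff.1 hv).2 (h ▸ huK)
      have hmem : s(u, v) ∈ Eplus ∪ Eminus := by simp [hpart, hne]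
      exact ⟨fun h => (Finset.mem_union.1 hmem).resolve_left h,
        fun h h' => Finset.disjoint_left.1 hdisj h' h⟩
    have hsum := Finset.card_filter_add_card_filter_not (s := C \ K) fun v => s(u, v) ∈ Eplus
    rw [hneg] at hsum
    have hle' : (((C \ K).filter fun v => s(u, v) ∈ Eplus).card : ℝ) ≤ 36 * ε * K.card :=
      (Nat.cast_le.2 hle).trans (hout u huK)
    rw [← hsum, Nat.cast_add] at hbig
    have hεK : 0 < ε * (K.card : ℝ) := mul_pos hε0 hKpos
    rw [← Nat.cast_lt (α := ℝ)]
    linarith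
  refine ⟨hlt, fun σ σ' ⟨c, hc⟩ hσ' => costCC_lt_of_split Eplus Eminus hAB hlt ?_ hσ'⟩
  intro a ha b hb
  rw [(hc a).1 (Finset.mem_inter.1 ha).1, (hc b).1 (Finset.mem_sdiff.1 hb).1]
end

section
/- Let G = (V, E) be a finite graph where every vertex has a self-loop, let N_u denote the neighbor set of u (so u ∈ N_u) and d_u = |N_u| ≥ 1, and fix ε ∈ (0,1). Call an ordered pair (u,v) of distinct vertices degree-similar if ε·d_v ≤ d_u ≤ d_v/ε, and admissible if (u,v) is degree-similar and the number of common neighbors w ∈ N_u ∩ N_v such that both (w,u) and (w,v) are degree-similar is at least ε·min(d_u, d_v). Then for every vertex u, the number of vertices v such that (u,v) is admissible is at most d_u/ε³. -/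
open Finset
open scoped Classical

/-- `(u, v)` is degree-similar: `ε·d_v ≤ d_u ≤ d_v/ε`, where `d_w = |N w|`. -/
def DegSim {V : Type*} (N : V → Finset V) (ε : ℝ) (u v : V) : Prop :=
  ε * ((N v).card : ℝ) ≤ ((N u).card : ℝ) ∧ ((N u).card : ℝ) ≤ ((N v).card : ℝ) / ε

/-- `(u, v)` is admissible: the vertices are distinct, degree-similar, and have at
least `ε·min(d_u, d_v)` common neighbors that are degree-similar to both. -/
def Admissible {V : Type*} [DecidableEq V] (N : V → Finset V) (ε : ℝ) (u v : V) : Prop :=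
  u ≠ v ∧ DegSim N ε u v ∧
    ε * min ((N u).card : ℝ) ((N v).card : ℝ) ≤
      ((((N u) ∩ (N v)).filter fun w => DegSim N ε w u ∧ DegSim N ε w v).card : ℝ)

/-- Lemma 3.8(i), counting argument: every vertex `u` has at most `d_u/ε³`
admissible partners. The graph has a self-loop at every vertex (`u ∈ N u`) and
is undirected (`v ∈ N u ↔ u ∈ N v`). -/
theorem admissible_degree_bound {V : Type*} [Fintype V] [DecidableEq V]
    (N : V → Finset V) (hself : ∀ u, u ∈ N u) (hsymm : ∀ u v, u ∈ N v ↔ v ∈ N u)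
    (ε : ℝ) (hε0 : 0 < ε) (hε1 : ε < 1) (u : V) :
    (((Finset.univ : Finset V).filter fun v => Admissible N ε u v).card : ℝ)
      ≤ ((N u).card : ℝ) / ε ^ 3 := by
  have hd : (0 : ℝ) < ((N u).card : ℝ) := by
    exact_mod_cast Finset.card_pos.mpr ⟨u, hself u⟩
  set A := (Finset.univ : Finset V).filter fun v => Admissible N ε u v with hA
  set D := (N u).filter fun w => DegSim N ε w u with hD
  have hlow : ∀ v ∈ A, ε ^ 2 * ((N u).card : ℝ) ≤
      ((D.bipartiteAbove (fun v w => w ∈ N v) v).card : ℝ) := by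
    intro v hv
    obtain ⟨-, ⟨-, hv2⟩, hcommon⟩ := (Finset.mem_filter.mp hv).2
    have hmin : ε * ((N u).card : ℝ) ≤ min ((N u).card : ℝ) ((N v).card : ℝ) := by
      refine le_min (by nlinarith) ?_
      rw [le_div_iff₀ hε0] at hv2
      linarith
    calc ε ^ 2 * ((N u).card : ℝ) = ε * (ε * ((N u).card : ℝ)) := by ring
      _ ≤ ε * min ((N u).card : ℝ) ((N v).card : ℝ) := by gcongr
      _ ≤ _ := hcommon
      _ ≤ _ := by
        refine Nat.cast_le.mpr (Finset.card_le_card fun w hw => ?_)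
        simp only [Finset.mem_filter, Finset.mem_inter] at hw
        simp only [hD, Finset.mem_bipartiteAbove, Finset.mem_filter]
        exact ⟨⟨hw.1.1, hw.2.1⟩, hw.1.2⟩
  have hupp : ∀ w ∈ D, ((A.bipartiteBelow (fun v w => w ∈ N v) w).card : ℝ) ≤
      ((N u).card : ℝ) / ε := by
    intro w hw
    refine le_trans (Nat.cast_le.mpr (Finset.card_le_card fun v hv => ?_))
      (Finset.mem_filter.mp hw).2.2
    exact (hsymm w v).mp (Finset.mem_bipartiteBelow _ |>.mp hv).2
  have hDcard : (D.card : ℝ) ≤ ((N u).card : ℝ) :=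
    Nat.cast_le.mpr (Finset.card_filter_le _ _)
  have hcount : (A.card : ℝ) * (ε ^ 2 * ((N u).card : ℝ)) ≤
      ((N u).card : ℝ) * (((N u).card : ℝ) / ε) := by
    calc (A.card : ℝ) * (ε ^ 2 * ((N u).card : ℝ))
        ≤ ∑ v ∈ A, ((D.bipartiteAbove (fun v w => w ∈ N v) v).card : ℝ) := by
          simpa only [nsmul_eq_mul] using Finset.card_nsmul_le_sum A _ _ hlow
      _ = ∑ w ∈ D, ((A.bipartiteBelow (fun v w => w ∈ N v) w).card : ℝ) := by
          exact_mod_cast Finset.sum_card_bipartiteAbove_eq_sum_card_bipartiteBelow _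
      _ ≤ (D.card : ℝ) * (((N u).card : ℝ) / ε) := by
          simpa only [nsmul_eq_mul] using Finset.sum_le_card_nsmul D _ _ hupp
      _ ≤ _ := by gcongr
  rw [mul_div_assoc', le_div_iff₀ hε0] at hcount
  rw [le_div_iff₀ (by positivity)]
  exact le_of_mul_le_mul_right (by linarith) hd
end

section
/- Let V' be a finite nonempty set with n' = |V'|, fix v ∈ V', and let nonnegative reals y^s_∅, y^s_u, y^s_{uv} be given for all s ∈ {1,…,n'} and u ∈ V' (where y^s_{vv} denotes y^s_v). Assume: (i) y^s_{uv} ≤ y^s_u ≤ y^s_∅ for all s, u; (ii) for every s, Σ_{u∈V'} y^s_{uv} = s·y^s_v; (iii) Σ_{s=1}^{n'} y^s_v = 1; and (iv) y_∅ := Σ_{s=1}^{n'} y^s_∅ > 0. Then Σ_{s=1}^{n'} (y^s_∅/y_∅) · Σ_{u∈V'} (y^s_u/(s·y^s_∅)) · (y^s_{uv}/y^s_u) = 1/y_∅, where terms with a zero denominator are interpreted as 0 (which is consistent since (i) forces the corresponding numerators to vanish). -/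
open Finset

/-- Lemma 4.2: in the set-based rounding procedure, one samples a cluster
size `s` with probability `y^s_∅ / y_∅`, then a pivot `u` with probability
`y^s_u / (s·y^s_∅)`, and then `v` joins the cluster with probability
`y^s_{uv} / y^s_u`; the overall probability that a fixed vertex `v` is
clustered in one execution is exactly `1 / y_∅`. Terms with zero denominators
are `0`, which is Lean's division convention. Here `yE s = y^s_∅`,
`yU s u = y^s_u`, and `yUV s u = y^s_{uv}` (for the fixed vertex `v`, with the
convention `yUV s v = yU s v`). -/
theorem prob_clustered {V : Type*} [Fintype V] [Nonempty V] (v : V)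
    (yE : ℕ → ℝ) (yU : ℕ → V → ℝ) (yUV : ℕ → V → ℝ)
    (hvv : ∀ s, yUV s v = yU s v)
    (hnn : ∀ s u, 0 ≤ yUV s u)
    (h1 : ∀ s u, yUV s u ≤ yU s u)
    (h2 : ∀ s u, yU s u ≤ yE s)
    (hsum : ∀ s ∈ Finset.Icc 1 (Fintype.card V), ∑ u : V, yUV s u = (s : ℝ) * yU s v)
    (hone : ∑ s ∈ Finset.Icc 1 (Fintype.card V), yU s v = 1)
    (hpos : 0 < ∑ s ∈ Finset.Icc 1 (Fintype.card V), yE s) :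
    ∑ s ∈ Finset.Icc 1 (Fintype.card V),
        (yE s / ∑ t ∈ Finset.Icc 1 (Fintype.card V), yE t) *
          ∑ u : V, (yU s u / ((s : ℝ) * yE s)) * (yUV s u / yU s u)
      = 1 / ∑ t ∈ Finset.Icc 1 (Fintype.card V), yE t := by
  rw [← hone, Finset.sum_div]
  refine Finset.sum_congr rfl fun s hs => ?_
  have hs0 : (s : ℝ) ≠ 0 := by
    have := (Finset.mem_Icc.mp hs).1
    exact_mod_cast (by omega : s ≠ 0)
  have hterm : ∀ u, yU s u / ((s : ℝ) * yE s) * (yUV s u / yU s u)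
      = yUV s u / ((s : ℝ) * yE s) := by
    intro u
    by_cases hu : yU s u = 0
    · have huv : yUV s u = 0 := le_antisymm (hu ▸ h1 s u) (hnn s u)
      simp [hu, huv]
    · rw [mul_comm, div_mul_div_cancel₀ hu]
  rw [Finset.sum_congr rfl fun u _ => hterm u, ← Finset.sum_div, hsum s hs,
    mul_div_mul_left _ _ hs0]
  by_cases hE : yE s = 0
  · have hv : yU s v = 0 :=
      le_antisymm (hE ▸ h2 s v) ((hnn s v).trans (h1 s v))
    simp [hE, hv]
  · rw [mul_comm, div_mul_div_cancel₀ hE]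
end

section
/- Define f : ℝ → ℝ by f(x) = min(1.515 + x, 2). For all real numbers p, q, r, t with 0 ≤ p, q, r, t ≤ 1, t ≤ min(p, q, r), and p + q + r − 2t ≤ 1, one has (f(1−q) − 1)·p + (f(1−p) − 1)·q + (f(1−p) + f(1−q) − 2)·r + (4 − f(1−p) − f(1−q))·(p+q)·r − (f(1−p) + f(1−q))·p·q·(1−r) − 2·t·r − t ≥ 0. -/
/-- The budget coefficient for positive edges. -/
noncomputable def f (x : ℝ) : ℝ := min (1.515 + x) 2

lemma budget_sub_cost_low_of_t_eq_q {p q r : ℝ} (hp0 : 0 ≤ p) (hq1 : q ≤ 1) (hr0 : 0 ≤ r)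
    (hr1 : r ≤ 1) (hqr : q ≤ r) :
    0 ≤ p + q + 2 * r - 4 * p * q * (1 - r) - 2 * q * r - q := by
  nlinarith [mul_nonneg hp0 (mul_nonneg (sub_nonneg.2 hqr) (sub_nonneg.2 hr1)),
    mul_nonneg hp0 (sq_nonneg (2 * r - 1)), mul_nonneg hr0 (sub_nonneg.2 hq1)]

lemma budget_sub_cost_low_of_t_eq_r {p q r : ℝ} (hr0 : 0 ≤ r) (hr1 : r ≤ 1) (hrp : r ≤ p)
    (hrq : r ≤ q) (h : p + q ≤ 1 + r) :
    0 ≤ p + q + 2 * r - 4 * p * q * (1 - r) - 2 * r * r - r := by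
  have hs : 0 ≤ p + q - 2 * r := by linarith
  have hr : 0 ≤ 1 - r := sub_nonneg.2 hr1
  have hsq : 0 ≤ (1 - r) * (p - q) ^ 2 := by positivity
  suffices 0 ≤ p + q + r - (p + q) ^ 2 * (1 - r) - 2 * r * r by nlinarith
  nlinarith [mul_nonneg (mul_nonneg (sub_nonneg.2 h) hs) hr, mul_nonneg hr0 (sq_nonneg (r - 1 / 2)),
    mul_nonneg hr0 hr, mul_nonneg hr0 (sq_nonneg (r - 1)), mul_nonneg hs hr,
    mul_nonneg (mul_nonneg hr0 hs) hr]

lemma deficit_nonneg {x : ℝ} (hx : 0.515 ≤ x) (hx1 : x ≤ 1) : 0 ≤ (x - 0.515) * (1 - x) :=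
  mul_nonneg (by linarith) (by linarith)

lemma deficit_le (x : ℝ) : (x - 0.515) * (1 - x) ≤ 0.06 := by
  nlinarith [sq_nonneg (x - 0.7575)]

/-- The case `q = 0` of `budget_sub_cost_mixed_of_t_eq_r`. -/
lemma budget_sub_cost_mixed_left {p r : ℝ} (hr0 : 0 ≤ r) (hrp : r ≤ p) (hp1 : p ≤ 1) :
    0 ≤ p + r - 2 * r * r - (p - 0.515) * (1 - p) * r := by
  nlinarith [mul_nonneg hr0 (sub_nonneg.2 hrp), mul_nonneg hr0 (sub_nonneg.2 hp1),
    mul_nonneg (mul_nonneg hr0 (sub_nonneg.2 hp1)) (sub_nonneg.2 hp1)]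

lemma budget_sub_cost_mixed_corner {p : ℝ} (hp : 0.515 ≤ p) (hp1 : p ≤ 1) :
    0 ≤ 1 - 4 * p * (1 - p) - (p - 0.515) * (1 - p) * (1 - p) := by
  nlinarith [mul_nonneg (sub_nonneg.2 hp) (sq_nonneg (p - 0.5285)), sq_nonneg (p - 0.5285)]

/-- The case `q = 1 + r - p` of `budget_sub_cost_mixed_of_t_eq_r`. -/
lemma budget_sub_cost_mixed_right {p r : ℝ} (hr0 : 0 ≤ r) (hrp : r ≤ p) (hp : 0.515 ≤ p)
    (hp1 : p ≤ 1) :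
    0 ≤ 1 + 2 * r - 2 * r * r - 4 * p * (1 + r - p) * (1 - r)
      - (p - 0.515) * (1 - p) * ((1 + r - p) * (1 - r) + r) := by
  rcases le_total p 0.65 with h | h
  · have hcorner := budget_sub_cost_mixed_corner hp hp1
    have hdef : (p - 0.515) * (1 - p) * (1 + p - r) ≤ (p - 0.515) * 0.81 := by
      have : (1 - p) * (1 + p - r) ≤ 0.81 := by nlinarith
      nlinarith
    have : 0 ≤ r * (2 - 2 * r - 4 * p * (p - r) - (p - 0.515) * (1 - p) * (1 + p - r)) := by
      apply mul_nonneg hr0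
      nlinarith [mul_nonneg hr0 (sub_nonneg.2 hp)]
    nlinarith
  · have hdef : (p - 0.515) * (1 - p) * ((1 + r - p) * (1 - r) + r) ≤ 0.06 := by
      have : (1 + r - p) * (1 - r) + r ≤ 1 := by nlinarith
      nlinarith [deficit_le p, deficit_nonneg hp hp1]
    nlinarith [mul_nonneg hr0 (sub_nonneg.2 hrp),
      mul_nonneg (sub_nonneg.2 hp1) (sub_nonneg.2 h), mul_nonneg hr0 (sq_nonneg (r - 1 / 2)),
      mul_nonneg hr0 (sub_nonneg.2 hp1)]

lemma budget_sub_cost_mixed_of_t_eq_r {p q r : ℝ} (hr0 : 0 ≤ r) (hrp : r ≤ p) (hp : 0.515 ≤ p)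
    (hp1 : p ≤ 1) (hq : 0 ≤ q) (h : p + q ≤ 1 + r) :
    0 ≤ p + q + 2 * r - 4 * p * q * (1 - r) - 2 * r * r - r
      - (p - 0.515) * (1 - p) * (q * (1 - r) + r) := by
  have hleft := budget_sub_cost_mixed_left hr0 hrp hp1
  have hright := budget_sub_cost_mixed_right hr0 hrp hp hp1
  -- The expression is affine in `q`, with the slope compared to zero here.
  rcases le_total 0 (1 - 4 * p * (1 - r) - (p - 0.515) * (1 - p) * (1 - r)) with hs | hs
  · nlinarith [mul_nonneg hq hs]
  · nlinarith [mul_nonneg (sub_nonneg.2 h) (neg_nonneg.2 hs)]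

lemma budget_sub_cost_mixed_of_t_eq_q {p q r : ℝ} (hq0 : 0 ≤ q) (hqr : q ≤ r) (hp : 0.515 ≤ p)
    (hq : q ≤ 0.515) (hr1 : r ≤ 1) :
    0 ≤ p + q + 2 * r - 4 * p * q * (1 - r) - 2 * q * r - q
      - (p - 0.515) * (1 - p) * (q * (1 - r) + r) := by
  have hp0 : 0 ≤ p := by linarith
  have hw : q * (1 - r) + r ≤ 2 * r := by nlinarith
  have hdef : (p - 0.515) * (1 - p) * (q * (1 - r) + r) ≤ 0.06 * (2 * r) :=
    mul_le_mul (deficit_le p) hw (by nlinarith) (by norm_num)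
  nlinarith [mul_nonneg hp0 (mul_nonneg (sub_nonneg.2 hqr) (sub_nonneg.2 hr1)),
    mul_nonneg hp0 (sq_nonneg (2 * r - 1)), mul_nonneg (hq0.trans hqr) (sub_nonneg.2 hq)]

lemma budget_sub_cost_high_of_t_eq_r {p q r : ℝ} (hrp : r ≤ p) (hp : 0.515 ≤ p)
    (hp1 : p ≤ 1) (hq : 0.515 ≤ q) (hq1 : q ≤ 1) (h : p + q ≤ 1 + r) :
    0 ≤ p + q + 2 * r - 4 * p * q * (1 - r) - 2 * r * r - r
      - (p - 0.515) * (1 - p) * (q * (1 - r) + r)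
      - (q - 0.515) * (1 - q) * (p * (1 - r) + r) := by
  have hr0 : 0 ≤ r := by linarith
  have hr : 0 ≤ 1 - r := by linarith
  have hs : 0 ≤ p + q - 1.03 := by linarith
  have hdef : ∀ x y : ℝ, 0.515 ≤ x → x ≤ 1 → y ≤ 1 →
      (x - 0.515) * (1 - x) * (y * (1 - r) + r) ≤ 0.485 * (x - 0.515) := by
    intro x y hx hx1 hy1
    have : y * (1 - r) + r ≤ 1 := by nlinarith
    nlinarith [deficit_nonneg hx hx1]
  have hdefp := hdef p q hp hp1 hq1
  have hdefq := hdef q p hq hq1 hp1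
  have hsq : 0 ≤ (1 - r) * (p - q) ^ 2 := mul_nonneg hr (sq_nonneg _)
  suffices 0 ≤ p + q + r - (p + q) ^ 2 * (1 - r) - 2 * r * r - 0.485 * (p + q - 1.03) by nlinarith
  nlinarith [mul_nonneg (mul_nonneg (sub_nonneg.2 h) hs) hr,
    mul_nonneg hr0 (sq_nonneg (r - 1 / 2)), mul_nonneg hr0 hr, mul_nonneg hs hr,
    mul_nonneg (mul_nonneg hr0 hs) hr, mul_nonneg hr0 (sub_nonneg.2 h)]

lemma budget_sub_cost_high_of_t_eq_q {p q r : ℝ} (hqr : q ≤ r) (hqp : q ≤ p) (hq : 0.515 ≤ q)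
    (hp1 : p ≤ 1) (hr1 : r ≤ 1) :
    0 ≤ p + q + 2 * r - 4 * p * q * (1 - r) - 2 * q * r - q
      - (p - 0.515) * (1 - p) * (q * (1 - r) + r)
      - (q - 0.515) * (1 - q) * (p * (1 - r) + r) := by
  have hp : 0.515 ≤ p := hq.trans hqp
  have hdef : ∀ x y : ℝ, 0.515 ≤ x → x ≤ 1 → 0 ≤ y → y ≤ 1 →
      (x - 0.515) * (1 - x) * (y * (1 - r) + r) ≤ 0.06 * 1 := fun x y hx hx1 hy hy1 ↦
    mul_le_mul (deficit_le x) (by nlinarith) (by nlinarith) (by norm_num)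
  have hdefp := hdef p q hp hp1 (by linarith) (by linarith)
  have hdefq := hdef q p hq (by linarith) (by linarith) hp1
  have hp0 : 0 ≤ p := by linarith
  suffices 0.12 ≤ p * (2 * r - 1) ^ 2 + 2 * r * (1 - q) by
    nlinarith [mul_nonneg hp0 (mul_nonneg (sub_nonneg.2 hqr) (sub_nonneg.2 hr1))]
  rcases le_total q 0.85 with h | h
  · nlinarith [mul_nonneg hp0 (sq_nonneg (2 * r - 1))]
  · have : (0.49 : ℝ) ≤ (2 * r - 1) ^ 2 := by nlinarith
    nlinarith [mul_nonneg (by linarith : 0 ≤ r) (by linarith : 0 ≤ 1 - q)]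

lemma f_one_sub_of_le {x : ℝ} (hx : x ≤ 0.515) : f (1 - x) = 2 :=
  min_eq_right (by linarith)

lemma f_one_sub_of_ge {x : ℝ} (hx : 0.515 ≤ x) : f (1 - x) = 2 - (x - 0.515) := by
  rw [f, min_eq_left (by linarith)]
  ring

lemma triangle_plus_plus_minus_of_le {p q r t : ℝ} (hp1 : p ≤ 1) (hq0 : 0 ≤ q) (hr0 : 0 ≤ r)
    (hr1 : r ≤ 1) (htq : t ≤ q) (htr : t ≤ r) (hsum : p + q + r - 2 * t ≤ 1) (hqp : q ≤ p) :
    0 ≤ (f (1 - q) - 1) * p + (f (1 - p) - 1) * q + (f (1 - p) + f (1 - q) - 2) * r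
        + (4 - f (1 - p) - f (1 - q)) * (p + q) * r
        - (f (1 - p) + f (1 - q)) * p * q * (1 - r) - 2 * t * r - t := by
  rcases le_total r q with hrq | hqr
  · have ht : 0 ≤ (1 + 2 * r) * (r - t) := mul_nonneg (by linarith) (by linarith)
    have hs : p + q ≤ 1 + r := by linarith
    have hrp := hrq.trans hqp
    rcases le_total p 0.515 with hp | hp
    · rw [f_one_sub_of_le hp, f_one_sub_of_le (hqp.trans hp)]
      linarith [budget_sub_cost_low_of_t_eq_r hr0 hr1 hrp hrq hs]
    rcases le_total q 0.515 with hq | hq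
    · rw [f_one_sub_of_ge hp, f_one_sub_of_le hq]
      linarith [budget_sub_cost_mixed_of_t_eq_r hr0 hrp hp hp1 hq0 hs]
    · rw [f_one_sub_of_ge hp, f_one_sub_of_ge hq]
      linarith [budget_sub_cost_high_of_t_eq_r hrp hp hp1 hq (hqp.trans hp1) hs]
  · have ht : 0 ≤ (1 + 2 * r) * (q - t) := mul_nonneg (by linarith) (by linarith)
    rcases le_total p 0.515 with hp | hp
    · rw [f_one_sub_of_le hp, f_one_sub_of_le (hqp.trans hp)]
      linarith [budget_sub_cost_low_of_t_eq_q (hq0.trans hqp) (hqp.trans hp1) hr0 hr1 hqr]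
    rcases le_total q 0.515 with hq | hq
    · rw [f_one_sub_of_ge hp, f_one_sub_of_le hq]
      linarith [budget_sub_cost_mixed_of_t_eq_q hq0 hqr hp hq hr1]
    · rw [f_one_sub_of_ge hp, f_one_sub_of_ge hq]
      linarith [budget_sub_cost_high_of_t_eq_q hqr hqp hq hp1 hr1]

/-- The `++-` triangle inequality (budget minus cost is nonnegative) in the ideal
analysis of the pivot-based rounding: `p = y_ab`, `q = y_ac`, `r = y_bc`, `t = y_abc`. -/
theorem triangle_plus_plus_minus (p q r t : ℝ)
    (hp0 : 0 ≤ p) (hp1 : p ≤ 1) (hq0 : 0 ≤ q) (hq1 : q ≤ 1)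
    (hr0 : 0 ≤ r) (hr1 : r ≤ 1) (ht0 : 0 ≤ t) (ht1 : t ≤ 1)
    (htp : t ≤ p) (htq : t ≤ q) (htr : t ≤ r)
    (hsum : p + q + r - 2 * t ≤ 1) :
    0 ≤ (f (1 - q) - 1) * p + (f (1 - p) - 1) * q + (f (1 - p) + f (1 - q) - 2) * r
        + (4 - f (1 - p) - f (1 - q)) * (p + q) * r
        - (f (1 - p) + f (1 - q)) * p * q * (1 - r) - 2 * t * r - t := by
  rcases le_total q p with h | h
  · exact triangle_plus_plus_minus_of_le hp1 hq0 hr0 hr1 htq htr hsum h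
  · linarith [triangle_plus_plus_minus_of_le hq1 hp0 hr0 hr1 htp htr
      (by linarith : q + p + r - 2 * t ≤ 1) h]
end

section
/- Define f : ℝ → ℝ by f(x) = min(1.515 + x, 2). For all real numbers p, q, r with 0 ≤ p, q, r ≤ 1 and max(p + q − 1, 0) ≤ r ≤ min(p, q), one has (f(1−q) − 1)·p + (f(1−p) − 1)·q + (f(1−p) + f(1−q) − 3)·r + (4 − f(1−p) − f(1−q))·(p+q)·r − (f(1−p) + f(1−q))·p·q·(1−r) − 2·r² ≥ 0. -/
/-- A quadratic with leading coefficient `-2` that is nonnegative at the endpoints of an interval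
is nonnegative on the interval. -/
lemma nonneg_of_endpoints {c d l h r : ℝ} (hl : l ≤ r) (hh : r ≤ h)
    (h₁ : 0 ≤ c + d * l - 2 * l ^ 2) (h₂ : 0 ≤ c + d * h - 2 * h ^ 2) :
    0 ≤ c + d * r - 2 * r ^ 2 := by
  rcases hl.eq_or_lt with rfl | hlt
  · exact h₁
  have hpos : 0 < h - l := by linarith
  refine nonneg_of_mul_nonneg_right (a := h - l) ?_ hpos
  have e : (h - l) * (c + d * r - 2 * r ^ 2) =
      (h - r) * (c + d * l - 2 * l ^ 2) + (r - l) * (c + d * h - 2 * h ^ 2)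
        + 2 * ((h - l) * (r - l) * (h - r)) := by ring
  rw [e]
  have := sub_nonneg.2 hh
  have := sub_nonneg.2 hl
  positivity

/-- The left-hand side as a function of `p`, `q`, `r` and the coefficients `a = f (1 - p)`,
`b = f (1 - q)`. -/
def gap (a b p q r : ℝ) : ℝ :=
  (b - 1) * p + (a - 1) * q + (a + b - 3) * r + (4 - a - b) * (p + q) * r
    - (a + b) * p * q * (1 - r) - 2 * r ^ 2

lemma gap_nonneg_of_endpoints {a b p q l h r : ℝ} (hl : l ≤ r) (hh : r ≤ h)
    (h₁ : 0 ≤ gap a b p q l) (h₂ : 0 ≤ gap a b p q h) : 0 ≤ gap a b p q r := by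
  have key := nonneg_of_endpoints (c := (b - 1) * p + (a - 1) * q - (a + b) * p * q)
    (d := a + b - 3 + (4 - a - b) * (p + q) + (a + b) * p * q) hl hh
    (by unfold gap at h₁; linarith) (by unfold gap at h₂; linarith)
  unfold gap
  linarith

lemma f_eq_two {p : ℝ} (hp : p ≤ 0.515) : f (1 - p) = 2 :=
  min_eq_right (by linarith)

lemma f_eq_sub {p : ℝ} (hp : 0.515 ≤ p) : f (1 - p) = 2.515 - p := by
  rw [f, min_eq_left (by linarith)]
  ring

lemma cubic_nonneg {q : ℝ} (hq1 : q ≤ 1) :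
    0 ≤ 1.515 - 6.03 * q + 6.515 * q ^ 2 - q ^ 3 := by
  nlinarith [sq_nonneg (q - 0.5266)]

/-- With `t = p + q - 1`, this is the gap at `r = t` in the range `p ≤ 0.515 ≤ q`. -/
lemma quadratic_nonneg {q t : ℝ} (hq : 0.515 ≤ q) (hq1 : q ≤ 1) (ht : 0 ≤ t) (ht' : t ≤ 0.515) :
    0 ≤ (1.515 - 6.03 * q + 6.515 * q ^ 2 - q ^ 3) + t * (2.515 - q - (4.515 - q) * q ^ 2)
      + t ^ 2 * (-2.515 + 5.515 * q - q ^ 2) := by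
  have hcubic := cubic_nonneg hq1
  have hlead : 0 ≤ -2.515 + 5.515 * q - q ^ 2 := by nlinarith
  rcases le_total 0 (2.515 - q - (4.515 - q) * q ^ 2) with hA | hA
  · positivity
  have hq' : 0.68 ≤ q := by
    by_contra! h
    nlinarith [mul_nonneg (mul_nonneg (sub_nonneg.2 hq) (sub_nonneg.2 h.le))
      (show 0 ≤ q by linarith)]
  -- Bound the quadratic below by replacing `t ^ 2` with its tangent at `t = 0.35`;
  -- the resulting affine function of `t` is nonnegative at `t = 0` and `t = 0.515`.
  have hzero : 0 ≤ (1.515 - 6.03 * q + 6.515 * q ^ 2 - q ^ 3)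
      - 0.1225 * (-2.515 + 5.515 * q - q ^ 2) := by
    nlinarith [sq_nonneg (q - 0.68)]
  have hend : 0 ≤ (1.515 - 6.03 * q + 6.515 * q ^ 2 - q ^ 3)
      - 0.1225 * (-2.515 + 5.515 * q - q ^ 2)
      + 0.515 * ((2.515 - q - (4.515 - q) * q ^ 2) + 0.7 * (-2.515 + 5.515 * q - q ^ 2)) := by
    nlinarith [sq_nonneg (q - 0.68)]
  linarith [mul_nonneg hlead (sq_nonneg (t - 0.35)), mul_nonneg (sub_nonneg.2 ht') hzero,
    mul_nonneg ht hend]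

lemma gap_self_nonneg {p q : ℝ} (hp0 : 0 ≤ p) (hpq : p ≤ q) (hq1 : q ≤ 1) :
    0 ≤ gap (f (1 - p)) (f (1 - q)) p q p := by
  rcases le_total q 0.515 with hq | hq
  · rw [f_eq_two hq, f_eq_two (hpq.trans hq)]
    unfold gap
    nlinarith [mul_nonneg (hp0.trans hpq) (sq_nonneg (1 - 2 * p))]
  rcases le_total p 0.515 with hp | hp
  · rw [f_eq_sub hq, f_eq_two hp]
    unfold gap
    nlinarith [mul_nonneg hp0 (sub_nonneg.2 hq1),
      mul_nonneg (mul_nonneg hp0 (sub_nonneg.2 hq)) (sub_nonneg.2 hq1)]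
  · rw [f_eq_sub hq, f_eq_sub hp]
    unfold gap
    nlinarith [mul_nonneg (sub_nonneg.2 hp) (sq_nonneg (p - 0.7)),
      mul_nonneg (sub_nonneg.2 hp) (sq_nonneg (q - 0.7))]

lemma gap_zero_nonneg {p q : ℝ} (hp0 : 0 ≤ p) (hpq : p ≤ q) (hs : p + q ≤ 1) :
    0 ≤ gap (f (1 - p)) (f (1 - q)) p q 0 := by
  rcases le_total q 0.515 with hq | hq
  · rw [f_eq_two hq, f_eq_two (hpq.trans hq)]
    unfold gap
    nlinarith [sq_nonneg (p - q)]
  · rw [f_eq_sub hq, f_eq_two (by linarith)]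
    unfold gap
    rcases le_total 0 (1.515 - 5.515 * q + q ^ 2) with hA | hA
    · nlinarith [mul_nonneg hp0 hA]
    · nlinarith [cubic_nonneg (q := q) (by linarith)]

lemma gap_add_sub_one_nonneg {p q : ℝ} (hpq : p ≤ q) (hq1 : q ≤ 1) (hs : 1 ≤ p + q) :
    0 ≤ gap (f (1 - p)) (f (1 - q)) p q (p + q - 1) := by
  rcases le_total q 0.515 with hq | hq
  · rw [f_eq_two hq, f_eq_two (hpq.trans hq)]
    unfold gap
    nlinarith [mul_nonneg (show 0 ≤ 2 - p - q by linarith) (sq_nonneg (p - q))]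
  rcases le_total p 0.515 with hp | hp
  · rw [f_eq_sub hq, f_eq_two hp]
    unfold gap
    have key := quadratic_nonneg hq hq1 (t := p + q - 1) (by linarith) (by linarith)
    linarith
  · rw [f_eq_sub hq, f_eq_sub hp]
    unfold gap
    nlinarith [mul_nonneg (sub_nonneg.2 hp) (sub_nonneg.2 hq1), sq_nonneg (p - q)]

lemma gap_nonneg_of_le {p q r : ℝ} (hp0 : 0 ≤ p) (hpq : p ≤ q) (hq1 : q ≤ 1) (hr0 : 0 ≤ r)
    (hrlow : p + q - 1 ≤ r) (hrp : r ≤ p) : 0 ≤ gap (f (1 - p)) (f (1 - q)) p q r := by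
  have hself := gap_self_nonneg hp0 hpq hq1
  rcases le_total (p + q) 1 with hs | hs
  · exact gap_nonneg_of_endpoints hr0 hrp (gap_zero_nonneg hp0 hpq hs) hself
  · exact gap_nonneg_of_endpoints hrlow hrp (gap_add_sub_one_nonneg hpq hq1 hs) hself

/-- The reduced form (equation (17)) of the `++-` triangle inequality in the ideal
analysis of the pivot-based rounding, under `y_abc = y_bc = r`. -/
theorem triangle_plus_plus_minus_reduced (p q r : ℝ)
    (hp0 : 0 ≤ p) (hp1 : p ≤ 1) (hq0 : 0 ≤ q) (hq1 : q ≤ 1)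
    (hr0 : 0 ≤ r) (hr1 : r ≤ 1)
    (hrlow : max (p + q - 1) 0 ≤ r) (hrhigh : r ≤ min p q) :
    0 ≤ (f (1 - q) - 1) * p + (f (1 - p) - 1) * q + (f (1 - p) + f (1 - q) - 3) * r
        + (4 - f (1 - p) - f (1 - q)) * (p + q) * r
        - (f (1 - p) + f (1 - q)) * p * q * (1 - r) - 2 * r ^ 2 := by
  have hlow := (le_max_left _ _).trans hrlow
  rcases le_total p q with hpq | hqp
  · have h := gap_nonneg_of_le hp0 hpq hq1 hr0 hlow (hrhigh.trans (min_le_left _ _))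
    unfold gap at h
    linarith
  · have h := gap_nonneg_of_le hq0 hqp hp1 hr0 (by linarith) (hrhigh.trans (min_le_right _ _))
    unfold gap at h
    linarith
end

section
/- For every real number x with 0 ≤ x ≤ 1/2, one has x²·min(1.515 + x, 2) + 1 − 4x + 2x² ≥ 0; equivalently, min(1.515 + x, 2) ≥ (−1 + 4x − 2x²)/x² for all x ∈ (0, 1/2]. -/
/-- The polynomial form of the budget inequality, valid for all nonnegative `x`. -/
lemma sq_mul_min_budget_nonneg {x : ℝ} (hx : 0 ≤ x) :
    0 ≤ x ^ 2 * min (1.515 + x) 2 + 1 - 4 * x + 2 * x ^ 2 := by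
  rcases min_choice (1.515 + x) 2 with h | h <;> rw [h]
  · nlinarith [mul_nonneg hx (sq_nonneg (x - 0.47337)), sq_nonneg (x - 0.47337)]
  · nlinarith [sq_nonneg (2 * x - 1)]

/-- The inequality justifying the choice of the constant `1.515` in the budget
coefficient `f(x) = min(1.515 + x, 2)` for positive edges. -/
theorem constant_1515_choice :
    (∀ x : ℝ, 0 ≤ x → x ≤ 1 / 2 →
      0 ≤ x ^ 2 * min (1.515 + x) 2 + 1 - 4 * x + 2 * x ^ 2) ∧
    (∀ x : ℝ, 0 < x → x ≤ 1 / 2 →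
      (-1 + 4 * x - 2 * x ^ 2) / x ^ 2 ≤ min (1.515 + x) 2) := by
  refine ⟨fun x hx _ => sq_mul_min_budget_nonneg hx, fun x hx _ => ?_⟩
  rw [div_le_iff₀ (by positivity)]
  linarith [sq_mul_min_budget_nonneg hx.le]
end

section
/- For all real numbers p, q with 0.69 ≤ q ≤ 1 and max(1 − q, 0) ≤ p ≤ 0.515, setting r = p + q − 1, one has 0.5·p + q + 0.5·r + 0.5·(p+q)·r − 3.5·p·q·(1−r) − 2·r² ≥ 0. -/
/-- Inequality (19) in Case 2b of the `++-` triangle analysis. -/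
theorem case2b (p q r : ℝ) (hq0 : 0.69 ≤ q) (hq1 : q ≤ 1)
    (hp0 : max (1 - q) 0 ≤ p) (hp1 : p ≤ 0.515) (hr : r = p + q - 1) :
    0 ≤ 0.5 * p + q + 0.5 * r + 0.5 * (p + q) * r - 3.5 * p * q * (1 - r) - 2 * r ^ 2 := by
  obtain ⟨hpq, hp⟩ := max_le_iff.mp hp0
  subst hr
  norm_num at hq0 hp1
  nlinarith [mul_nonneg hp (sq_nonneg (q - 0.69))]
end

section
/- Define f : ℝ → ℝ by f(x) = min(1.515 + x, 2). For all real numbers p, q, t with 0 ≤ p, q, t ≤ 1, t ≤ p, and t ≤ q, one has f(1−p) + f(1−q) − 2 + (f(1−p) + f(1−q))·p·q − 2·t ≥ 0. -/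
theorem three_halves_le_f {x : ℝ} (hx : 0 ≤ x) : 3 / 2 ≤ f x := by
  unfold f
  exact le_min (by linarith) (by norm_num)

/-- The derivative claim in the `++-` triangle analysis justifying the reduction
to the case `y_bc = y_abc`. -/
theorem derivative_claim (p q t : ℝ)
    (hp0 : 0 ≤ p) (hp1 : p ≤ 1) (hq0 : 0 ≤ q) (hq1 : q ≤ 1)
    (ht0 : 0 ≤ t) (ht1 : t ≤ 1) (htp : t ≤ p) (htq : t ≤ q) :
    0 ≤ f (1 - p) + f (1 - q) - 2 + (f (1 - p) + f (1 - q)) * p * q - 2 * t := by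
  have hS : 3 ≤ f (1 - p) + f (1 - q) := by
    linarith [three_halves_le_f (sub_nonneg.2 hp1), three_halves_le_f (sub_nonneg.2 hq1)]
  have hpq : t * t ≤ p * q := mul_le_mul htp htq ht0 hp0
  have hmul : 3 * (p * q) ≤ (f (1 - p) + f (1 - q)) * (p * q) :=
    mul_le_mul_of_nonneg_right hS (mul_nonneg hp0 hq0)
  nlinarith [sq_nonneg (3 * t - 1)]
end
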